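/- Let n ≥ 1 and let a = (a_1, ..., a_{n+1}) be a unit vector in ℝ^{n+1} with Σ_j a_j = 0 and a_1 ≥ a_2 ≥ ... ≥ a_{n+1}. Then p_a(0) ≤ 1 / (2 · max{a_1, −a_{n+1}}). -/

import Mathlib

open MeasureTheory ProbabilityTheory Real

/-- `p` is the (continuous) probability density of `∑ⱼ aⱼ Xⱼ`, where `X₁, X₂, ...` are
i.i.d. standard exponential random variables (density `e^{-x} 1_{(0,∞)}(x)` on `ℝ`). -/
def IsExpSumDensity {m : ℕ} (a : Fin m → ℝ) (p : ℝ → ℝ) : Prop :=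
  Continuous p ∧
    Measure.map (fun x : Fin m → ℝ => ∑ j, a j * x j) (Measure.pi fun _ => expMeasure 1)
      = volume.withDensity fun x => ENNReal.ofReal (p x)

open scoped ENNReal

instance isProbabilityMeasure_expMeasure_one : IsProbabilityMeasure (expMeasure 1) :=
  isProbabilityMeasure_expMeasure one_pos

/-- A Pólya frequency function of order two, that is, a log-concave function. -/
def IsPF2 (f : ℝ → ℝ≥0∞) : Prop :=
  ∀ x y d : ℝ, x ≤ y → 0 ≤ d → f x * f (y + d) ≤ f (x + d) * f y

/-- The function `x ↦ e^{r x} f x` is monotone. -/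
def ExpTiltMonotone (r : ℝ) (f : ℝ → ℝ≥0∞) : Prop :=
  ∀ x y : ℝ, x ≤ y → f x ≤ ENNReal.ofReal (exp (r * (y - x))) * f y

lemma ENNReal.mul_add_mul_le_mul_add_mul_of_le {a b c d : ℝ≥0∞} (hab : a ≤ b) (hcd : c ≤ d) :
    a * d + b * c ≤ a * c + b * d := by
  obtain ⟨s, rfl⟩ := exists_add_of_le hab
  obtain ⟨t, rfl⟩ := exists_add_of_le hcd
  calc a * (c + t) + (a + s) * c ≤ a * (c + t) + (a + s) * c + s * t := le_self_add
    _ = a * c + (a + s) * (c + t) := by ring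

lemma IsPF2.lconvolution {f g : ℝ → ℝ≥0∞} (hf : IsPF2 f) (hg : IsPF2 g)
    (hfm : Measurable f) (hgm : Measurable g) : IsPF2 (f ⋆ₗ g) := by
  intro x y d hxy hd
  let A : ℝ × ℝ → ℝ≥0∞ := fun q =>
    (f q.1 * g (-q.1 + (x + d))) * (f (q.2 - d) * g (-(q.2 - d) + y))
  let B : ℝ × ℝ → ℝ≥0∞ := fun q =>
    (f (q.1 - d) * g (-(q.1 - d) + x)) * (f q.2 * g (-q.2 + (y + d)))
  have hA : Measurable A := by fun_prop
  have hB : Measurable B := by fun_prop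
  have hIA : ∫⁻ q, A q ∂(volume.prod volume) = (f ⋆ₗ g) (x + d) * (f ⋆ₗ g) y := by
    rw [lintegral_prod_mul (f := fun z => f z * g (-z + (x + d)))
      (g := fun w => f (w - d) * g (-(w - d) + y)) (by fun_prop) (by fun_prop),
      lintegral_sub_right_eq_self (fun w => f w * g (-w + y)) d]
    rfl
  have hIB : ∫⁻ q, B q ∂(volume.prod volume) = (f ⋆ₗ g) x * (f ⋆ₗ g) (y + d) := by
    rw [lintegral_prod_mul (f := fun z => f (z - d) * g (-(z - d) + x))
      (g := fun w => f w * g (-w + (y + d))) (by fun_prop) (by fun_prop),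
      lintegral_sub_right_eq_self (fun w => f w * g (-w + x)) d]
    rfl
  have key : ∀ z w : ℝ, z ≤ w → B (z, w) + B (w, z) ≤ A (z, w) + A (w, z) := by
    intro z w hzw
    have h1 := hf (z - d) (w - d) d (by linarith) hd
    have h2 := hg (x + d - w) (y + d - w) (w - z) (by linarith) (by linarith)
    simp only [sub_add_cancel] at h1
    rw [show y + d - w + (w - z) = -z + (y + d) by ring,
      show x + d - w + (w - z) = -z + (x + d) by ring,
      show x + d - w = -w + (x + d) by ring, show y + d - w = -w + (y + d) by ring] at h2
    have h3 := ENNReal.mul_add_mul_le_mul_add_mul_of_le h1 h2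
    simp only [A, B]
    rw [show -(z - d) + x = -z + (x + d) by ring, show -(w - d) + x = -w + (x + d) by ring,
      show -(z - d) + y = -z + (y + d) by ring, show -(w - d) + y = -w + (y + d) by ring]
    calc _ = _ := by ring
      _ ≤ _ := h3
      _ = _ := by ring
  have key' : ∀ q : ℝ × ℝ, B q + B q.swap ≤ A q + A q.swap := by
    rintro ⟨z, w⟩
    rcases le_total z w with h | h
    · exact key z w h
    · have := key w z h
      rwa [add_comm, add_comm (A _)] at this
  have hswap : ∀ F : ℝ × ℝ → ℝ≥0∞, Measurable F →
      ∫⁻ q, (F q + F q.swap) ∂(volume.prod volume)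
        = 2 * ∫⁻ q, F q ∂(volume.prod volume) := by
    intro F hF
    rw [lintegral_add_left hF, lintegral_prod_swap, two_mul]
  have hle := lintegral_mono (μ := (volume : Measure ℝ).prod volume) key'
  rw [hswap A hA, hswap B hB, hIA, hIB] at hle
  exact (ENNReal.mul_le_mul_iff_right two_ne_zero ENNReal.ofNat_ne_top).mp hle

lemma ExpTiltMonotone.lconvolution {r : ℝ} {f : ℝ → ℝ≥0∞} (hf : ExpTiltMonotone r f)
    (hfm : Measurable f) {g : ℝ → ℝ≥0∞} (hgm : Measurable g) :
    ExpTiltMonotone r (g ⋆ₗ f) := by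
  intro x y hxy
  simp only [lconvolution_def]
  rw [← lintegral_const_mul _ (by fun_prop)]
  refine lintegral_mono fun z => ?_
  have h := hf (-z + x) (-z + y) (by linarith)
  rw [show -z + y - (-z + x) = y - x by ring] at h
  calc g z * f (-z + x) ≤ g z * (ENNReal.ofReal (exp (r * (y - x))) * f (-z + y)) := by gcongr
    _ = _ := by ring

/-- The density of `c X`, where `X` is a standard exponential random variable. -/
noncomputable def scaledExpPDF (c x : ℝ) : ℝ≥0∞ :=
  ENNReal.ofReal |c⁻¹| * exponentialPDF 1 (c⁻¹ * x)

@[fun_prop]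
lemma measurable_scaledExpPDF (c : ℝ) : Measurable (scaledExpPDF c) := by
  unfold scaledExpPDF exponentialPDF
  fun_prop

lemma map_mul_expMeasure {c : ℝ} (hc : c ≠ 0) :
    Measure.map (c * ·) (expMeasure 1) = volume.withDensity (scaledExpPDF c) := by
  have hm : Measurable (exponentialPDF 1) := by unfold exponentialPDF; fun_prop
  have hexp : expMeasure 1 = volume.withDensity (exponentialPDF 1) := rfl
  refine Measure.ext_of_lintegral _ fun φ hφ => ?_
  rw [lintegral_map hφ (by fun_prop), hexp,
    lintegral_withDensity_eq_lintegral_mul _ hm (by fun_prop),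
    lintegral_withDensity_eq_lintegral_mul _ (by fun_prop) hφ]
  conv_lhs => rw [← Real.smul_map_volume_mul_left (inv_ne_zero hc)]
  rw [lintegral_smul_measure, lintegral_map (by fun_prop) (by fun_prop), smul_eq_mul,
    ← lintegral_const_mul _ (by fun_prop)]
  refine lintegral_congr fun x => ?_
  simp only [Pi.mul_apply, scaledExpPDF, mul_inv_cancel_left₀ hc]
  ring

lemma isPF2_scaledExpPDF (c : ℝ) : IsPF2 (scaledExpPDF c) := by
  intro x y d hxy hd
  unfold scaledExpPDF
  suffices h : exponentialPDF 1 (c⁻¹ * x) * exponentialPDF 1 (c⁻¹ * (y + d))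
      ≤ exponentialPDF 1 (c⁻¹ * (x + d)) * exponentialPDF 1 (c⁻¹ * y) by
    calc _ = ENNReal.ofReal |c⁻¹| * ENNReal.ofReal |c⁻¹| *
          (exponentialPDF 1 (c⁻¹ * x) * exponentialPDF 1 (c⁻¹ * (y + d))) := by ring
      _ ≤ ENNReal.ofReal |c⁻¹| * ENNReal.ofReal |c⁻¹| *
          (exponentialPDF 1 (c⁻¹ * (x + d)) * exponentialPDF 1 (c⁻¹ * y)) := by gcongr
      _ = _ := by ring
  generalize c⁻¹ = r
  by_cases h1 : 0 ≤ r * x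
  swap
  · simp [exponentialPDF_of_neg (not_le.mp h1)]
  by_cases h2 : 0 ≤ r * (y + d)
  swap
  · simp [exponentialPDF_of_neg (not_le.mp h2)]
  have h3 : 0 ≤ r * (x + d) ∧ 0 ≤ r * y := by
    rcases le_total 0 r with hr | hr
    · constructor <;> nlinarith [mul_nonneg hr hd, mul_nonneg hr (sub_nonneg.2 hxy)]
    · constructor <;>
        nlinarith [mul_nonneg (neg_nonneg.2 hr) hd,
          mul_nonneg (neg_nonneg.2 hr) (sub_nonneg.2 hxy)]
  rw [exponentialPDF_of_nonneg h1, exponentialPDF_of_nonneg h2, exponentialPDF_of_nonneg h3.1,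
    exponentialPDF_of_nonneg h3.2, ← ENNReal.ofReal_mul (by positivity),
    ← ENNReal.ofReal_mul (by positivity)]
  refine ENNReal.ofReal_le_ofReal (le_of_eq ?_)
  simp only [one_mul, ← Real.exp_add]
  ring_nf

lemma expTiltMonotone_scaledExpPDF {c : ℝ} (hc : 0 < c) :
    ExpTiltMonotone c⁻¹ (scaledExpPDF c) := by
  intro x y hxy
  unfold scaledExpPDF
  rw [mul_left_comm]
  gcongr
  have hr : 0 < c⁻¹ := inv_pos.2 hc
  generalize c⁻¹ = r at hr
  by_cases h1 : 0 ≤ r * x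
  swap
  · simp [exponentialPDF_of_neg (not_le.mp h1)]
  have h2 : 0 ≤ r * y := h1.trans (by gcongr)
  rw [exponentialPDF_of_nonneg h1, exponentialPDF_of_nonneg h2,
    ← ENNReal.ofReal_mul (by positivity)]
  refine ENNReal.ofReal_le_ofReal (le_of_eq ?_)
  simp only [one_mul, ← Real.exp_add]
  ring_nf

/-- The law of `∑ⱼ bⱼ Xⱼ` for i.i.d. standard exponential random variables `Xⱼ`. -/
noncomputable def expSumLaw {m : ℕ} (b : Fin m → ℝ) : Measure ℝ :=
  Measure.map (fun x : Fin m → ℝ => ∑ j, b j * x j) (Measure.pi fun _ => expMeasure 1)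

instance isProbabilityMeasure_expSumLaw {m : ℕ} (b : Fin m → ℝ) :
    IsProbabilityMeasure (expSumLaw b) :=
  Measure.isProbabilityMeasure_map (by apply Measurable.aemeasurable; fun_prop)

lemma expSumLaw_succAbove {m : ℕ} (b : Fin (m + 1) → ℝ) (i : Fin (m + 1)) :
    expSumLaw b = Measure.map (b i * ·) (expMeasure 1) ∗ expSumLaw (fun j => b (i.succAbove j)) := by
  have h := measurePreserving_piFinSuccAbove (fun _ : Fin (m + 1) => expMeasure 1) i
  unfold expSumLaw Measure.conv
  rw [Measure.map_prod_map _ _ (by fun_prop) (by fun_prop), ← h.map_eq,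
    Measure.map_map (by fun_prop) (MeasurableEquiv.measurable _),
    Measure.map_map (by fun_prop) (by fun_prop)]
  congr 1
  ext x
  simp only [Function.comp_apply, Fin.sum_univ_succAbove _ i]
  rfl

lemma exists_withDensity_conv_expSumLaw {r : ℝ} {m : ℕ} (b : Fin m → ℝ) {f : ℝ → ℝ≥0∞}
    (hfm : Measurable f) (hf : IsPF2 f) (hfr : ExpTiltMonotone r f) :
    ∃ g : ℝ → ℝ≥0∞, Measurable g ∧ IsPF2 g ∧ ExpTiltMonotone r g ∧
      expSumLaw b ∗ volume.withDensity f = volume.withDensity g := by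
  induction m generalizing f with
  | zero =>
    refine ⟨f, hfm, hf, hfr, ?_⟩
    simp [expSumLaw, Measure.map_const]
  | succ m ih =>
    rw [expSumLaw_succAbove b 0, Measure.conv_comm (Measure.map _ _), Measure.conv_assoc]
    rcases eq_or_ne (b 0) 0 with h0 | h0
    · obtain ⟨g, hg⟩ := ih (fun j => b (Fin.succAbove 0 j)) hfm hf hfr
      refine ⟨g, hg.1, hg.2.1, hg.2.2.1, ?_⟩
      simpa [h0, Measure.map_const] using hg.2.2.2
    · rw [map_mul_expMeasure h0, conv_withDensity_eq_lconvolution (by fun_prop) hfm]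
      exact ih _ (measurable_lconvolution _ (by fun_prop) hfm)
        ((isPF2_scaledExpPDF _).lconvolution hf (by fun_prop) hfm)
        (hfr.lconvolution hfm (by fun_prop))

lemma exists_expSumLaw_eq_withDensity {m : ℕ} (a : Fin m → ℝ) (i : Fin m) (hi : 0 < a i) :
    ∃ g : ℝ → ℝ≥0∞, Measurable g ∧ IsPF2 g ∧ ExpTiltMonotone (a i)⁻¹ g ∧
      expSumLaw a = volume.withDensity g := by
  obtain ⟨m, rfl⟩ : ∃ k, m = k + 1 := Nat.exists_eq_add_one.2 (Fin.pos i)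
  rw [expSumLaw_succAbove a i, Measure.conv_comm, map_mul_expMeasure hi.ne']
  exact exists_withDensity_conv_expSumLaw _ (by fun_prop) (isPF2_scaledExpPDF _)
    (expTiltMonotone_scaledExpPDF hi)

lemma forall_of_ae_of_isClosed {P : ℝ → Prop} (hP : ∀ᵐ u : ℝ, P u) (hc : IsClosed {u | P u})
    (u : ℝ) : P u := by
  have h := (Measure.dense_of_ae hP).closure_eq
  rw [hc.closure_eq] at h
  exact h.ge (Set.mem_univ u)

lemma ae_comp_add_left {P : ℝ → Prop} (hP : ∀ᵐ u : ℝ, P u) (x : ℝ) : ∀ᵐ u : ℝ, P (x + u) :=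
  (measurePreserving_add_left volume x).quasiMeasurePreserving.ae hP

lemma IsPF2.mul_le_mul_of_ae_eq {g : ℝ → ℝ≥0∞} (hg : IsPF2 g) {p : ℝ → ℝ} (hp : Continuous p)
    (hp0 : ∀ x, 0 ≤ p x) (h : ∀ᵐ x : ℝ, g x = ENNReal.ofReal (p x))
    {x y d : ℝ} (hxy : x ≤ y) (hd : 0 ≤ d) : p x * p (y + d) ≤ p (x + d) * p y := by
  have key : ∀ u : ℝ, p (x + u) * p (y + d + u) ≤ p (x + d + u) * p (y + u) := by
    refine forall_of_ae_of_isClosed ?_ (isClosed_le (by fun_prop) (by fun_prop))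
    filter_upwards [ae_comp_add_left h x, ae_comp_add_left h y, ae_comp_add_left h (x + d),
      ae_comp_add_left h (y + d)] with u h1 h2 h3 h4
    have := hg (x + u) (y + u) d (by linarith) hd
    rw [add_right_comm x, add_right_comm y, h1, h2, h3, h4, ← ENNReal.ofReal_mul (hp0 _),
      ← ENNReal.ofReal_mul (hp0 _)] at this
    exact (ENNReal.ofReal_le_ofReal_iff (mul_nonneg (hp0 _) (hp0 _))).1 this
  simpa using key 0

lemma ExpTiltMonotone.le_of_ae_eq {r : ℝ} {g : ℝ → ℝ≥0∞} (hg : ExpTiltMonotone r g) {p : ℝ → ℝ}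
    (hp : Continuous p) (hp0 : ∀ x, 0 ≤ p x) (h : ∀ᵐ x : ℝ, g x = ENNReal.ofReal (p x))
    {x y : ℝ} (hxy : x ≤ y) : p x ≤ exp (r * (y - x)) * p y := by
  have key : ∀ u : ℝ, p (x + u) ≤ exp (r * (y - x)) * p (y + u) := by
    refine forall_of_ae_of_isClosed ?_ (isClosed_le (by fun_prop) (by fun_prop))
    filter_upwards [ae_comp_add_left h x, ae_comp_add_left h y] with u h1 h2
    have := hg (x + u) (y + u) (by linarith)
    rw [h1, h2, ← ENNReal.ofReal_mul (exp_pos _).le, add_sub_add_right_eq_sub] at this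
    exact (ENNReal.ofReal_le_ofReal_iff (mul_nonneg (exp_pos _).le (hp0 _))).1 this
  simpa using key 0

/-- A continuous log-concave function is quasiconcave. -/
lemma min_le_of_mul_le_mul {f : ℝ → ℝ} (hf : Continuous f) (hf0 : ∀ x, 0 ≤ f x)
    (h4 : ∀ x y d : ℝ, x ≤ y → 0 ≤ d → f x * f (y + d) ≤ f (x + d) * f y)
    {x y z : ℝ} (hxy : x ≤ y) (hyz : y ≤ z) : min (f x) (f z) ≤ f y := by
  by_contra! hlt
  obtain ⟨hyx, hyz'⟩ := lt_min_iff.1 hlt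
  obtain ⟨m, hm, hmin⟩ := isCompact_Icc.exists_isMinOn
    (Set.nonempty_Icc.2 (hxy.trans hyz)) hf.continuousOn
  have hmin : ∀ u ∈ Set.Icc x z, f m ≤ f u := hmin
  have hv : f m ≤ f y := hmin y ⟨hxy, hyz⟩
  have hK : IsCompact (Set.Icc x z ∩ f ⁻¹' {f m}) :=
    isCompact_Icc.inter_right (isClosed_singleton.preimage hf)
  obtain ⟨l, ⟨⟨hxl, hlz⟩, hl⟩, hleast⟩ := hK.exists_isLeast ⟨m, hm, rfl⟩
  have hl : f l = f m := hl
  have hpos : 0 < f l := by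
    have hmx : 0 < f x := (hf0 y).trans_lt hyx
    have hmz : 0 < f z := (hf0 y).trans_lt hyz'
    have := h4 x l (z - l) hxl (by linarith)
    rw [add_sub_cancel] at this
    by_contra hn
    have h0 : f l = 0 := le_antisymm (not_lt.1 hn) (hf0 l)
    rw [h0, mul_zero] at this
    exact absurd (mul_pos hmx hmz) (not_lt.2 this)
  have hxl' : x < l := lt_of_le_of_ne hxl (by rintro rfl; linarith)
  have hlz' : l < z := lt_of_le_of_ne hlz (by rintro rfl; linarith)
  set δ := min (l - x) (z - l)
  have hδ : 0 < δ := lt_min (by linarith) (by linarith)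
  have hδ1 : δ ≤ l - x := min_le_left _ _
  have hδ2 : δ ≤ z - l := min_le_right _ _
  have h1 : f m < f (l - δ) := by
    refine lt_of_le_of_ne (hmin _ ⟨by linarith, by linarith⟩) fun he => ?_
    have : l ≤ l - δ := hleast ⟨⟨by linarith, by linarith⟩, he.symm⟩
    linarith
  have h2 : f m ≤ f (l + δ) := hmin _ ⟨by linarith, by linarith⟩
  have h3 := h4 (l - δ) l δ (by linarith) hδ.le
  rw [sub_add_cancel, hl] at h3
  rw [hl] at hpos
  nlinarith

lemma integrable_comp_abs {f : ℝ → ℝ} (hf : IntegrableOn f (Set.Ioi 0)) :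
    Integrable fun x : ℝ => f |x| := by
  have hpos : IntegrableOn (fun x : ℝ => f |x|) (Set.Ioi 0) :=
    hf.congr_fun (fun x hx => by rw [abs_of_pos hx]) measurableSet_Ioi
  have hneg : IntegrableOn (fun x : ℝ => f |x|) (Set.Iic 0) := by
    have m : MeasurableEmbedding fun x : ℝ => -x := (Homeomorph.neg ℝ).measurableEmbedding
    rw [← Measure.map_neg_eq_self (volume : Measure ℝ), m.integrableOn_map_iff]
    simpa [Function.comp_def] using (integrableOn_Ici_iff_integrableOn_Ioi).2 hpos
  rw [← integrableOn_univ, ← Set.Iic_union_Ioi (a := (0 : ℝ))]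
  exact hneg.union hpos

lemma laplace_integral {r : ℝ} (hr : 0 < r) (c : ℝ) :
    Integrable (fun x : ℝ => c * exp (-r * |x|)) ∧
    Integrable (fun x : ℝ => x * (c * exp (-r * |x|))) ∧
    ∫ x : ℝ, c * exp (-r * |x|) = 2 * c / r ∧ ∫ x : ℝ, x * (c * exp (-r * |x|)) = 0 := by
  have h1 : IntegrableOn (fun x : ℝ => exp (-r * x)) (Set.Ioi 0) := exp_neg_integrableOn_Ioi 0 hr
  have h2 : IntegrableOn (fun x : ℝ => x * exp (-r * x)) (Set.Ioi 0) := by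
    simpa using integrableOn_rpow_mul_exp_neg_mul_rpow (p := 1) (s := 1) (by norm_num) one_pos hr
  have e1 : Integrable (fun x : ℝ => exp (-r * |x|)) := 
    integrable_comp_abs h1
  have e2 : Integrable (fun x : ℝ => |x| * exp (-r * |x|)) := 
    integrable_comp_abs h2
  refine ⟨e1.const_mul c, ?_, ?_, ?_⟩
  · refine (e2.const_mul c).mono (by fun_prop) (Filter.Eventually.of_forall fun x => le_of_eq ?_)
    simp only [norm_mul, Real.norm_eq_abs, abs_abs]
    ring
  · rw [integral_const_mul, integral_comp_abs (f := fun x => exp (-r * x)),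
      integral_exp_mul_Ioi (by linarith)]
    simp
    ring
  · have := integral_neg_eq_self (fun x : ℝ => x * (c * exp (-r * |x|))) volume
    simp only [abs_neg, neg_mul, integral_neg] at this ⊢
    linarith

/-- A centred log-concave density `p` with `x ↦ e^{r x} p x` monotone satisfies `p 0 ≤ r / 2`. -/
lemma apply_zero_le_of_centred {r : ℝ} (hr : 0 < r) {p : ℝ → ℝ} (hp : Continuous p)
    (hp0 : ∀ x, 0 ≤ p x)
    (h4 : ∀ x y d : ℝ, x ≤ y → 0 ≤ d → p x * p (y + d) ≤ p (x + d) * p y)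
    (hmono : ∀ x y : ℝ, x ≤ y → p x ≤ exp (r * (y - x)) * p y)
    (hint : Integrable p) (hint1 : Integrable fun x => x * p x)
    (hone : ∫ x, p x = 1) (hzero : ∫ x, x * p x = 0) : p 0 ≤ r / 2 := by
  obtain ⟨k0, k1, kone, kzero⟩ := laplace_integral hr (p 0)
  set D : ℝ → ℝ := fun x => p x - p 0 * exp (-r * |x|) with hD
  have hD0 : Integrable D := hint.sub k0
  have hxD : (fun x => x * D x) = fun x => x * p x - x * (p 0 * exp (-r * |x|)) := by
    ext x; simp only [hD]; ring
  have hD1 : Integrable fun x => x * D x := by rw [hxD]; exact hint1.sub k1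
  have hDz : ∫ x, x * D x = 0 := by
    rw [hxD, integral_sub hint1 k1, hzero, kzero, sub_zero]
  suffices hmain : 0 ≤ ∫ x, D x by
    rw [hD, integral_sub hint k0, hone, kone, sub_nonneg, div_le_one hr] at hmain
    linarith
  have hright : ∀ x, 0 ≤ x → 0 ≤ D x := by
    intro x hx
    have h := hmono 0 x hx
    rw [sub_zero] at h
    have h' : exp (-r * |x|) * p 0 ≤ exp (-r * |x|) * (exp (r * x) * p x) := by gcongr
    rw [← mul_assoc, ← Real.exp_add, abs_of_nonneg hx] at h'
    simp only [hD, abs_of_nonneg hx]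
    simp only [neg_mul, neg_add_cancel, exp_zero, one_mul] at h' ⊢
    linarith
  have hleft : ∀ x y, x ≤ y → y ≤ 0 → D y < 0 → D x < 0 := by
    intro x y hxy hy hDy
    have hφ : ∀ u, u ≤ 0 → (D u < 0 ↔ p u * exp (-r * u) < p 0) := by
      intro u hu
      simp only [hD, abs_of_nonpos hu, sub_neg]
      rw [show -r * -u = -(-r * u) by ring, exp_neg, ← div_eq_mul_inv, lt_div_iff₀ (exp_pos _)]
    rw [hφ y hy] at hDy
    rw [hφ x (hxy.trans hy)]
    have hq := min_le_of_mul_le_mul (f := fun u => p u * exp (-r * u)) (by fun_prop)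
      (fun u => mul_nonneg (hp0 u) (exp_pos _).le) (by
        intro x y d hxy hd
        have := mul_le_mul_of_nonneg_right (h4 x y d hxy hd) (exp_pos (-r * (x + (y + d)))).le
        calc _ = p x * p (y + d) * exp (-r * (x + (y + d))) := by
              rw [mul_add (-r) x, Real.exp_add]; ring
          _ ≤ _ := this
          _ = _ := by
              rw [show -r * (x + (y + d)) = -r * (x + d) + -r * y by ring, Real.exp_add]; ring)
      hxy hy
    simp only [mul_zero, exp_zero, mul_one] at hq
    rcases min_le_iff.1 hq with h | h
    · exact h.trans_lt hDy
    · exact absurd hDy (not_lt.2 h)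
  by_cases hneg : ∃ y, D y < 0
  swap
  · push Not at hneg
    exact integral_nonneg hneg
  set S : Set ℝ := {y | D y < 0} with hS
  have hSle : ∀ y ∈ S, y ≤ 0 := fun y hy => by
    by_contra! h
    exact absurd (hright y h.le) (not_le.2 hy)
  have hbdd : BddAbove S := ⟨0, hSle⟩
  set t := sSup S with ht
  have ht0 : t ≤ 0 := csSup_le hneg hSle
  have hsign : ∀ x, 0 ≤ (x - t) * D x := by
    intro x
    rcases lt_or_ge x t with hx | hx
    · obtain ⟨y, hy, hxy⟩ := exists_lt_of_lt_csSup hneg hx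
      exact mul_nonneg_of_nonpos_of_nonpos (by linarith) (hleft x y hxy.le (hSle y hy) hy).le
    · rcases hx.eq_or_lt with rfl | hx
      · simp
      · refine mul_nonneg (by linarith) ?_
        by_contra! h
        exact absurd (le_csSup hbdd h) (not_le.2 hx)
  have hexp : ∫ x, (x - t) * D x = -t * ∫ x, D x := by
    rw [← integral_const_mul, ← zero_add (∫ x, -t * D x), ← hDz,
      ← integral_add hD1 (hD0.const_mul _)]
    congr 1; ext x; ring
  rcases ht0.eq_or_lt with h0 | h0
  · have hint' : Integrable fun x => (x - t) * D x := by simpa [h0] using hD1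
    have hz : (fun x => (x - t) * D x) =ᵐ[volume] 0 :=
      (integral_eq_zero_iff_of_nonneg hsign hint').1 (by rw [hexp, h0]; simp)
    have : D =ᵐ[volume] 0 := by
      filter_upwards [hz, Measure.ae_ne volume t] with x hx hxt
      exact (mul_eq_zero.1 hx).resolve_left (sub_ne_zero.2 hxt)
    rw [integral_congr_ae this]
    simp
  · have : 0 ≤ ∫ x, (x - t) * D x := integral_nonneg hsign
    rw [hexp] at this
    exact nonneg_of_mul_nonneg_right this (by linarith)

lemma integrable_id_expMeasure : Integrable (fun x : ℝ => x) (expMeasure 1) := by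
  have hm : Measurable (exponentialPDF 1) := by unfold exponentialPDF; fun_prop
  change Integrable _ (volume.withDensity (exponentialPDF 1))
  rw [integrable_withDensity_iff hm (by simp [exponentialPDF])]
  have h2 : IntegrableOn (fun x : ℝ => x * exp (-1 * x)) (Set.Ioi 0) := by
    simpa using integrableOn_rpow_mul_exp_neg_mul_rpow (p := 1) (s := 1) (b := 1)
      (by norm_num) one_pos one_pos
  rw [← integrableOn_Ici_iff_integrableOn_Ioi] at h2
  refine (h2.integrable_indicator measurableSet_Ici).congr (Filter.Eventually.of_forall fun x => ?_)
  by_cases hx : 0 ≤ x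
  · simp [exponentialPDF_of_nonneg hx, hx, ENNReal.toReal_ofReal (exp_pos _).le]
  · simp [exponentialPDF_of_neg (not_le.1 hx), hx]

lemma integrable_apply_expMeasure {m : ℕ} (j : Fin m) :
    Integrable (fun x : Fin m → ℝ => x j) (Measure.pi fun _ => expMeasure 1) :=
  integrable_comp_eval (μ := fun _ : Fin m => expMeasure 1) (i := j) (f := fun x => x)
    integrable_id_expMeasure

lemma integrable_id_expSumLaw {m : ℕ} (a : Fin m → ℝ) :
    Integrable (fun x : ℝ => x) (expSumLaw a) := by
  rw [expSumLaw, integrable_map_measure (by fun_prop) (by apply Measurable.aemeasurable; fun_prop)]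
  exact integrable_finsetSum _ fun j _ =>
    (integrable_apply_expMeasure j).const_mul (a j)

lemma integral_id_expSumLaw {m : ℕ} (a : Fin m → ℝ) (ha : ∑ j, a j = 0) :
    ∫ x, x ∂(expSumLaw a) = 0 := by
  rw [expSumLaw, integral_map (by apply Measurable.aemeasurable; fun_prop) (by fun_prop),
    integral_finsetSum _ fun j _ =>
      (integrable_apply_expMeasure j).const_mul (a j)]
  have h : ∀ j : Fin m, ∫ x : Fin m → ℝ, a j * x j ∂(Measure.pi fun _ => expMeasure 1)
      = a j * ∫ x, x ∂(expMeasure 1) := fun j => by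
    rw [integral_const_mul,
      integral_comp_eval (μ := fun _ : Fin m => expMeasure 1) (i := j) (f := fun x => x)
        (by fun_prop)]
  simp_rw [h]
  rw [← Finset.sum_mul, ha, zero_mul]

/-- If `∑ⱼ aⱼ = 0` then the density of `∑ⱼ aⱼ Xⱼ` at `0` is at most `1 / (2 aᵢ)`, for each
positive coefficient `aᵢ`. -/
lemma IsExpSumDensity.apply_zero_le {m : ℕ} {a : Fin m → ℝ} {p : ℝ → ℝ}
    (hp : IsExpSumDensity a p) (ha : ∑ j, a j = 0) (i : Fin m) (hi : 0 < a i) :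
    p 0 ≤ (2 * a i)⁻¹ := by
  obtain ⟨hpc, hpd⟩ := hp
  change expSumLaw a = _ at hpd
  obtain ⟨g, hgm, hg4, hgr, hgd⟩ := exists_expSumLaw_eq_withDensity a i hi
  set q : ℝ → ℝ := fun x => max (p x) 0
  have hqc : Continuous q := by fun_prop
  have hq0 : ∀ x, 0 ≤ q x := fun x => le_max_right _ _
  have hof : ∀ x, ENNReal.ofReal (p x) = ENNReal.ofReal (q x) := fun x => by
    simp [q, ENNReal.ofReal_max]
  simp_rw [hof] at hpd
  have hqm : Measurable fun x => ENNReal.ofReal (q x) := by fun_prop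
  have hae : ∀ᵐ x : ℝ, g x = ENNReal.ofReal (q x) :=
    (withDensity_eq_iff_of_sigmaFinite hgm.aemeasurable hqm.aemeasurable).1 (hgd.symm.trans hpd)
  have hlt : ∀ᵐ x : ℝ, ENNReal.ofReal (q x) < ∞ := by simp
  have hint := (integrable_withDensity_iff hqm hlt).1
    (hpd ▸ integrable_const (1 : ℝ) (μ := expSumLaw a))
  have hint1 := (integrable_withDensity_iff hqm hlt).1 (hpd ▸ integrable_id_expSumLaw a)
  have hone := integral_withDensity_eq_integral_toReal_smul hqm hlt (fun _ => (1 : ℝ))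
  have hzero := integral_withDensity_eq_integral_toReal_smul hqm hlt (fun x => x)
  rw [← hpd] at hone hzero
  rw [integral_id_expSumLaw a ha] at hzero
  simp only [ENNReal.toReal_ofReal (hq0 _), one_mul, smul_eq_mul, mul_one, integral_const,
    probReal_univ] at hint hint1 hone hzero
  simp_rw [mul_comm (q _)] at hzero
  have h := apply_zero_le_of_centred (inv_pos.2 hi) hqc hq0
    (fun x y d => hg4.mul_le_mul_of_ae_eq hqc hq0 hae)
    (fun x y => hgr.le_of_ae_eq hqc hq0 hae) hint hint1 hone.symm hzero.symm
  calc p 0 ≤ q 0 := le_max_left _ _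
    _ ≤ (a i)⁻¹ / 2 := h
    _ = (2 * a i)⁻¹ := by rw [mul_inv]; ring

lemma IsExpSumDensity.neg {m : ℕ} {a : Fin m → ℝ} {p : ℝ → ℝ} (hp : IsExpSumDensity a p) :
    IsExpSumDensity (fun j => -a j) fun x => p (-x) := by
  obtain ⟨hpc, hpd⟩ := hp
  refine ⟨by fun_prop, ?_⟩
  have hmap : Measure.map (fun x : Fin m → ℝ => ∑ j, -a j * x j) (Measure.pi fun _ => expMeasure 1)
      = Measure.map Neg.neg (Measure.map (fun x : Fin m → ℝ => ∑ j, a j * x j)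
        (Measure.pi fun _ => expMeasure 1)) := by
    rw [Measure.map_map (by fun_prop) (by fun_prop)]
    congr 1
    ext x
    simp
  rw [hmap, hpd]
  refine Measure.ext_of_lintegral _ fun φ hφ => ?_
  rw [lintegral_map hφ (by fun_prop), lintegral_withDensity_eq_lintegral_mul _ (by fun_prop)
    (by fun_prop), lintegral_withDensity_eq_lintegral_mul _ (by fun_prop) hφ,
    ← lintegral_neg_eq_self]
  simp

/-- **Webb's log-concavity bound.**
For a unit vector `a ∈ ℝ^{n+1}` with `∑ aⱼ = 0` and `a₁ ≥ a₂ ≥ ... ≥ a_{n+1}`,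
`p_a(0) ≤ 1/(2 max{a₁, -a_{n+1}})`. -/
theorem webb_logconcavity_bound (n : ℕ) (hn : 1 ≤ n)
    (a : EuclideanSpace ℝ (Fin (n + 1))) (hnorm : ‖a‖ = 1)
    (hsum : ∑ j, a j = 0) (hmono : ∀ i j : Fin (n + 1), i ≤ j → a j ≤ a i)
    (p : ℝ → ℝ) (hp : IsExpSumDensity (fun j => a j) p) :
    p 0 ≤ (2 * max (a 0) (-(a (Fin.last n))))⁻¹ := by
  have hpos : 0 < a 0 := by
    by_contra! h
    have hle : ∀ j ∈ Finset.univ, a j ≤ 0 := fun j _ => (hmono 0 j (Fin.zero_le j)).trans h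
    have ha : a = 0 := by
      ext j
      exact (Finset.sum_eq_zero_iff_of_nonpos hle).1 hsum j (Finset.mem_univ j)
    simp [ha] at hnorm
  rcases le_total (-(a (Fin.last n))) (a 0) with h | h
  · rw [max_eq_left h]
    exact hp.apply_zero_le hsum 0 hpos
  · rw [max_eq_right h]
    simpa using hp.neg.apply_zero_le (by simpa using hsum) (Fin.last n) (hpos.trans_le h)
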